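/- arXiv:2210.02292 — 3 statements merged into one kernel-verified Lean document; each statement's English description precedes it below -/
import Mathlib

section
/- Let s be a string and let v be a non-empty palindromic substring of s with an occurrence starting at position i ∈ occ(s,v). Let v₁ = link(v) and v₂ = link(v₁), and suppose |v₂| ≥ 1. Then there exists a non-empty palindromic substring u of s with link(u) = v₂ such that i + |v| − |v₁| ∈ overline-occ(s,u); that is, there is an occurrence j ∈ occ(s,u) with j + |u| − |v₂| = i + |v| − |v₁|. -/
noncomputable section
open scoped Classical

namespace DEE

variable {α : Type*}

/-- 1-indexed substring `s[i..j]` (empty if `i > j`). -/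
def substr (s : List α) (i j : ℕ) : List α := (s.drop (i - 1)).take (j + 1 - i)

/-- Set of start positions (1-indexed) of occurrences of `t` in `s`. -/
def occ (s t : List α) : Set ℕ :=
  {i | 1 ≤ i ∧ i + t.length - 1 ≤ s.length ∧ (s.drop (i - 1)).take t.length = t}

/-- `v` is a non-empty palindromic substring of `s`. -/
def IsPalSub (s v : List α) : Prop := v ≠ [] ∧ v.Palindrome ∧ v <:+: s

/-- `prelen s i`: length of the longest palindromic prefix of `s[i..|s|]`. -/
def prelen (s : List α) (i : ℕ) : ℕ :=
  sSup {l | 1 ≤ l ∧ l ≤ s.length + 1 - i ∧ (substr s i (i + l - 1)).Palindrome}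

/-- `suflen s i`: length of the longest palindromic suffix of `s[1..i]`. -/
def suflen (s : List α) (i : ℕ) : ℕ :=
  sSup {l | 1 ≤ l ∧ l ≤ i ∧ (substr s (i + 1 - l) i).Palindrome}

/-- longest palindromic prefix of `s[i..|s|]`. -/
def prepal (s : List α) (i : ℕ) : List α := substr s i (i + prelen s i - 1)

/-- longest palindromic suffix of `s[1..i]`. -/
def sufpal (s : List α) (i : ℕ) : List α := substr s (i + 1 - suflen s i) i

/-- The occurrence `s[i..j]` is a surface in `s`. -/
def Surface (s : List α) (i j : ℕ) : Prop :=
  1 ≤ i ∧ i ≤ j ∧ j ≤ s.length ∧ (substr s i j).Palindrome ∧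
    (∀ l, 1 ≤ l → l < i → ¬ (substr s l j).Palindrome) ∧
    (∀ r, j < r → r ≤ s.length → ¬ (substr s i r).Palindrome)

/-- length of the longest proper palindromic suffix of `t`. -/
def linklen (t : List α) : ℕ :=
  sSup {l | l < t.length ∧ (t.drop (t.length - l)).Palindrome}

/-- the longest proper palindromic suffix of `t` (possibly `[]`). -/
def link (t : List α) : List α := t.drop (t.length - linklen t)

/-- `overline-occ`: shifted occurrences `{i + |t| - |link t| : i ∈ occ s t}`. -/
def obar (s t : List α) : Set ℕ := (fun i => i + t.length - (link t).length) '' occ s t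

/-- Eq.(★): the family `S` of reduced occurrence sets represents `occ` for `s`. -/
def SatStar (s : List α) (S : List α → Set ℕ) : Prop :=
  ∀ v, IsPalSub s v →
    occ s v = S v ∪ ⋃ u ∈ {u : List α | IsPalSub s u ∧ link u = v}, (occ s u ∪ obar s u)

/-- number of non-empty palindromic substrings of `s` linking to `v`. -/
def linkcnt (s v : List α) : ℕ := {u | IsPalSub s u ∧ link u = v}.ncard

def precnt (s v : List α) : ℕ := {i | 1 ≤ i ∧ i ≤ s.length ∧ prepal s i = v}.ncard

def sufcnt (s v : List α) : ℕ := {i | 1 ≤ i ∧ i ≤ s.length ∧ sufpal s i = v}.ncard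

def cnt (s v : List α) : ℕ := sufcnt s v

/-- surfaced occurrences of `v` in `s`. -/
def surf (s v : List α) : Set ℕ := {i ∈ occ s v | Surface s i (i + v.length - 1)}

def presurf (s : List α) (i : ℕ) : List α :=
  if Surface s i (i + prelen s i - 1) then prepal s i else []

def sufsurf (s : List α) (i : ℕ) : List α :=
  if Surface s (i + 1 - suflen s i) i then sufpal s i else []

end DEE

namespace DEE

/-- The factor of `t` on the 0-indexed half-open interval `[a, b)` is a palindrome. -/
def PalOn {α : Type*} (t : List α) (a b : ℕ) : Prop :=
  ∀ x y, x + y + 1 = a + b → a ≤ x → x < b → t[x]? = t[y]?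

theorem palindrome_take_drop_iff {α : Type*} {t : List α} {a l : ℕ} (h : a + l ≤ t.length) :
    ((t.drop a).take l).Palindrome ↔ PalOn t a (a + l) := by
  have hlen : ((t.drop a).take l).length = l := by simp; omega
  have hget : ∀ x, x < l → ((t.drop a).take l)[x]? = t[a + x]? := fun x hx => by
    rw [List.getElem?_take_of_lt hx, List.getElem?_drop]
  constructor
  · intro hp x y hxy hx hxl
    have h1 := congrArg (fun r => r[x - a]?) hp.reverse_eq
    rw [List.getElem?_reverse (by omega), hlen, hget _ (by omega), hget _ (by omega)] at h1
    rw [show x = a + (x - a) by omega, ← h1]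
    congr 1
    omega
  · intro hp
    refine List.Palindrome.of_reverse_eq (List.ext_getElem? fun x => ?_)
    by_cases hx : x < l
    · rw [List.getElem?_reverse (by omega), hlen, hget _ (by omega), hget _ hx]
      exact hp _ _ (by omega) (by omega) (by omega)
    · rw [List.getElem?_eq_none (by simp; omega), List.getElem?_eq_none (by omega)]

theorem palindrome_drop_iff {α : Type*} {t : List α} {l : ℕ} (h : l ≤ t.length) :
    (t.drop (t.length - l)).Palindrome ↔ PalOn t (t.length - l) t.length := by
  have := palindrome_take_drop_iff (t := t) (a := t.length - l) (l := l) (by omega)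
  rwa [List.take_of_length_le (by simp; omega), Nat.sub_add_cancel h] at this

theorem PalOn.mirror {α : Type*} {t : List α} {a b c d : ℕ} (h : PalOn t a b)
    (hcd : PalOn t c d) (hca : c ≤ a) (hbd : b ≤ d) :
    PalOn t (c + d - b) (c + d - a) := by
  intro x y hxy hx hxb
  rw [hcd x (c + d - 1 - x) (by omega) (by omega) (by omega),
    hcd y (c + d - 1 - y) (by omega) (by omega) (by omega)]
  exact h _ _ (by omega) (by omega) (by omega)

theorem PalOn.central {α : Type*} {t : List α} {a b c d : ℕ} (h : PalOn t c d)
    (hca : c ≤ a) (heq : a + b = c + d) : PalOn t a b :=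
  fun x y hxy hx hxb => h x y (by omega) (by omega) (by omega)

theorem linklen_isGreatest {α : Type*} {t : List α} (ht : t ≠ []) :
    IsGreatest {l | l < t.length ∧ (t.drop (t.length - l)).Palindrome} (linklen t) := by
  have hb : BddAbove {l | l < t.length ∧ (t.drop (t.length - l)).Palindrome} :=
    ⟨t.length, fun l hl => hl.1.le⟩
  exact ⟨Nat.sSup_mem ⟨0, List.length_pos_iff.2 ht, by simpa using List.Palindrome.nil⟩ hb,
    fun l hl => le_csSup hb hl⟩

theorem length_link {α : Type*} {t : List α} (ht : t ≠ []) : (link t).length = linklen t := by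
  have := (linklen_isGreatest ht).1.1
  simp [link]
  omega

theorem IsPalSub.of_mem_occ {α : Type*} {s t : List α} {i : ℕ} (ht : t ≠ [])
    (hp : t.Palindrome) (hi : i ∈ occ s t) : IsPalSub s t :=
  ⟨ht, hp, hi.2.2 ▸ (List.take_prefix _ _).isInfix.trans (List.drop_suffix _ _).isInfix⟩

theorem add_mem_occ {α : Type*} {s t : List α} {i j l : ℕ} (hi : i ∈ occ s t)
    (hl : j + l ≤ t.length) : i + j ∈ occ s ((t.drop j).take l) := by
  obtain ⟨h1, h2, h3⟩ := hi
  have hlen : ((t.drop j).take l).length = l := by simp; omega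
  refine ⟨by omega, by omega, ?_⟩
  rw [hlen]
  conv_rhs => rw [← h3]
  rw [List.drop_take, List.take_take, List.drop_drop, min_eq_left (by omega)]
  congr 2
  omega

/-- In a palindrome of length `n` whose longest proper palindromic suffixes have lengths `m`
and then `k`, some palindromic factor longer than `k` ends at position `n - m + k`. -/
theorem exists_palOn_ending {α : Type*} {t : List α} {n m k : ℕ} (ht : PalOn t 0 n)
    (hmn : m < n) (hkm : k < m) (hm : PalOn t (n - m) n)
    (hmax : ∀ l < m, PalOn t (n - l) n → l ≤ k) :
    ∃ j < n - m, PalOn t j (n - m + k) := by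
  have hle : m - k ≤ n - m := by
    by_contra! hlt
    have hc : PalOn t (n - m) m := ht.central (by omega) (by omega)
    have hs := hc.mirror hm le_rfl (by omega)
    have := hmax (2 * m - n) (by omega) (by convert hs using 1 <;> omega)
    omega
  rcases hle.eq_or_lt with heq | hlt
  · refine ⟨0, by omega, ?_⟩
    convert hm.mirror ht (by omega) le_rfl using 1 <;> omega
  · exact ⟨m - k, hlt, ht.central (by omega) (by omega)⟩

end DEE

/-- If `v` is a non-empty palindromic substring of `s` occurring at
position `i`, `v₁ = link v`, `v₂ = link v₁` with `|v₂| ≥ 1`, then there exists a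
non-empty palindromic substring `u` of `s` with `link u = v₂` such that
`i + |v| - |v₁| ∈ overline-occ(s,u)`. -/
theorem overline_occur {α : Type*} (s v : List α) (hv : DEE.IsPalSub s v)
    (i : ℕ) (hi : i ∈ DEE.occ s v)
    (h2 : 1 ≤ (DEE.link (DEE.link v)).length) :
    ∃ u, DEE.IsPalSub s u ∧ DEE.link u = DEE.link (DEE.link v) ∧
      i + v.length - (DEE.link v).length ∈ DEE.obar s u := by
  have hv0 : v ≠ [] := hv.1
  have hw0 : DEE.link v ≠ [] := by
    intro h
    rw [h] at h2
    simp [DEE.link] at h2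
  obtain ⟨⟨hmn, hmp⟩, -⟩ := DEE.linklen_isGreatest hv0
  obtain ⟨⟨hkm, hkp⟩, hkmax⟩ := DEE.linklen_isGreatest hw0
  have hk1 := h2
  rw [DEE.length_link hw0] at hk1
  have hm := DEE.length_link hv0
  have hlink : DEE.link v = v.drop (v.length - DEE.linklen v) := rfl
  have hdrop : ∀ l ≤ DEE.linklen v,
      (DEE.link v).drop (DEE.linklen v - l) = v.drop (v.length - l) := by
    intro l hl
    rw [hlink, List.drop_drop]
    congr 1
    omega
  have hlink2 : DEE.link (DEE.link v) = v.drop (v.length - DEE.linklen (DEE.link v)) := by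
    rw [← hdrop _ (by omega), ← hm]
    rfl
  rw [hm] at hkm hkp
  rw [hdrop _ hkm.le] at hkp
  rw [hm, hlink2]
  have hmax : ∀ l < DEE.linklen v, DEE.PalOn v (v.length - l) v.length →
      l ≤ DEE.linklen (DEE.link v) := by
    intro l hl hp
    refine hkmax ⟨by omega, ?_⟩
    rw [hm, hdrop _ hl.le]
    exact (DEE.palindrome_drop_iff (by omega)).2 hp
  generalize DEE.linklen (DEE.link v) = k at *
  generalize DEE.linklen v = m at *
  have hP : DEE.PalOn v 0 v.length := by
    simpa using (DEE.palindrome_drop_iff (t := v) le_rfl).1 (by simpa using hv.2.1)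
  have hPm := (DEE.palindrome_drop_iff hmn.le).1 hmp
  have hPk := (DEE.palindrome_drop_iff (by omega)).1 hkp
  have hPe : DEE.PalOn v (v.length - m) (v.length - m + k) := by
    convert hPk.mirror hPm (by omega) le_rfl using 1 <;> omega
  obtain ⟨j₀, hj₀, hpj₀⟩ := DEE.exists_palOn_ending hP hmn hkm hPm hmax
  set Q : ℕ → Prop := fun j => j < v.length - m ∧ DEE.PalOn v j (v.length - m + k) with hQ
  obtain ⟨hj, hpj⟩ : Q (Nat.findGreatest Q (v.length - m)) :=
    Nat.findGreatest_spec (P := Q) hj₀.le ⟨hj₀, hpj₀⟩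
  have hjmax : ∀ x, Q x → x ≤ Nat.findGreatest Q (v.length - m) := fun x hx =>
    Nat.le_findGreatest hx.1.le hx
  generalize Nat.findGreatest Q (v.length - m) = j at *
  obtain ⟨l, hl⟩ : ∃ l, j + l = v.length - m + k := ⟨v.length - m + k - j, by omega⟩
  set u := (v.drop j).take l with hu
  have hul : u.length = l := by simp [hu]; omega
  have hu0 : u ≠ [] := List.ne_nil_of_length_pos (by omega)
  have hsuf : ∀ x ≤ l, u.drop (u.length - x) = (v.drop (v.length - m + k - x)).take x := by
    intro x hx
    rw [hul, hu, List.drop_take, List.drop_drop]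
    congr 2 <;> omega
  have hsufP : ∀ x ≤ l, ((u.drop (u.length - x)).Palindrome ↔
      DEE.PalOn v (v.length - m + k - x) (v.length - m + k)) := by
    intro x hx
    rw [hsuf x hx, DEE.palindrome_take_drop_iff (by omega), Nat.sub_add_cancel (by omega)]
  have hlen : DEE.linklen u = k := by
    refine (DEE.linklen_isGreatest hu0).unique ⟨⟨by omega, ?_⟩, ?_⟩
    · rw [hsufP k (by omega), Nat.add_sub_cancel]
      exact hPe
    · rintro x ⟨hx, hxp⟩
      by_contra! hkx
      have := hjmax _ ⟨by omega, (hsufP x (by omega)).1 hxp⟩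
      omega
  have hocc : i + j ∈ DEE.occ s u := DEE.add_mem_occ hi (by omega)
  have hup : u.Palindrome := (DEE.palindrome_take_drop_iff (by omega)).2 (hl ▸ hpj)
  refine ⟨u, .of_mem_occ hu0 hup hocc, ?_, i + j, hocc, ?_⟩
  · rw [DEE.link, hlen, hsuf k (by omega), Nat.add_sub_cancel]
    refine List.ext_getElem? fun x => ?_
    by_cases hx : x < k
    · rw [List.getElem?_take_of_lt hx, List.getElem?_drop, List.getElem?_drop,
        hPm _ (v.length - 1 - x) (by omega) (by omega) (by omega)]
      exact hPk _ _ (by omega) (by omega) (by omega)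
    · rw [List.getElem?_eq_none (by simp; omega), List.getElem?_eq_none (by simp; omega)]
  · simp only [DEE.length_link hu0, hlen, hul]
    omega
end
end

section
/- Let s be a non-empty string and suppose the family S satisfies Eq.(★) for s. Then there exists a non-empty palindromic substring v of s with 1 ∈ S(v), and there exists a non-empty palindromic substring v of s with |s| − |v| + 1 ∈ S(v). -/
noncomputable section
open scoped Classical

namespace DEE

/-- The longest proper palindromic suffix of a non-empty list is strictly shorter. -/
lemma length_link_lt {α : Type*} {t : List α} (ht : t ≠ []) : (link t).length < t.length := by
  have hpos : 0 < t.length := List.length_pos_iff.mpr ht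
  have hmem : linklen t ∈ {l | l < t.length ∧ (t.drop (t.length - l)).Palindrome} := by
    refine Nat.sSup_mem ⟨0, hpos, ?_⟩ ⟨t.length, fun l hl => hl.1.le⟩
    simpa using List.Palindrome.nil
  have hlt : linklen t < t.length := hmem.1
  rw [link, List.length_drop]
  omega

/-- Among the lists of bounded length satisfying `P`, one has maximal length. -/
lemma exists_maximal_length {α : Type*} {P : List α → Prop} {n : ℕ}
    (hne : ∃ v, P v) (hb : ∀ v, P v → v.length ≤ n) :
    ∃ v, P v ∧ ∀ u, P u → u.length ≤ v.length := by
  obtain ⟨v, hv, hmax⟩ := Nat.sSup_mem (s := List.length '' {v | P v})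
    (Set.Nonempty.image _ hne) ⟨n, by rintro _ ⟨v, hv, rfl⟩; exact hb v hv⟩
  refine ⟨v, hv, fun u hu => ?_⟩
  rw [hmax]
  exact le_csSup ⟨n, by rintro _ ⟨v, hv, rfl⟩; exact hb v hv⟩ ⟨u, hu, rfl⟩

lemma one_mem_occ_iff {α : Type*} {s t : List α} : 1 ∈ occ s t ↔ t <+: s := by
  constructor
  · rintro ⟨-, -, h⟩
    rw [List.prefix_iff_eq_take]
    simpa using h.symm
  · intro h
    refine ⟨le_rfl, by have := h.length_le; omega, ?_⟩
    simpa using (List.prefix_iff_eq_take.mp h).symm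

lemma mem_occ_of_suffix {α : Type*} {s t : List α} (h : t <:+ s) :
    s.length - t.length + 1 ∈ occ s t := by
  have hle := h.length_le
  refine ⟨by omega, by omega, ?_⟩
  rw [Nat.add_sub_cancel, ← List.suffix_iff_eq_drop.mp h, List.take_length]

lemma suffix_of_mem_occ {α : Type*} {s t : List α} {i : ℕ} (hi : i ∈ occ s t)
    (hend : i + t.length = s.length + 1) : t <:+ s := by
  obtain ⟨h1, -, h⟩ := hi
  rw [List.take_of_length_le (by rw [List.length_drop]; omega)] at h
  exact h ▸ List.drop_suffix _ _

/-- A position of `v` that is not inherited from a palindrome linking to `v` is stored in `S v`. -/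
lemma SatStar.mem {α : Type*} {s v : List α} {S : List α → Set ℕ} (hS : SatStar s S)
    (hv : IsPalSub s v) {i : ℕ} (hi : i ∈ occ s v)
    (hocc : ∀ u, IsPalSub s u → link u = v → i ∉ occ s u)
    (hobar : ∀ u, IsPalSub s u → link u = v → i ∉ obar s u) : i ∈ S v := by
  rw [hS v hv] at hi
  rcases hi with hi | hi
  · exact hi
  · simp only [Set.mem_iUnion, Set.mem_ofPred_eq] at hi
    obtain ⟨u, ⟨hu, hl⟩, hi | hi⟩ := hi
    · exact absurd hi (hocc u hu hl)
    · exact absurd hi (hobar u hu hl)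

end DEE

/-- If `S` satisfies Eq.(★) for a non-empty string `s`, then some
non-empty palindromic substring `v` of `s` has `1 ∈ S(v)`, and some non-empty
palindromic substring `v` of `s` has `|s| - |v| + 1 ∈ S(v)`. -/
theorem prenode_sufnode_nonempty {α : Type*} (s : List α) (hs : s ≠ [])
    (S : List α → Set ℕ) (hS : DEE.SatStar s S) :
    (∃ v, DEE.IsPalSub s v ∧ 1 ∈ S v) ∧
      (∃ v, DEE.IsPalSub s v ∧ s.length - v.length + 1 ∈ S v) := by
  constructor
  · obtain ⟨v, ⟨hne, hpal, hpre⟩, hmax⟩ := DEE.exists_maximal_length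
      (P := fun v => v ≠ [] ∧ v.Palindrome ∧ v <+: s) (n := s.length)
      ⟨[s.head hs], by simp, List.Palindrome.singleton _, [s.head hs].prefix_append s.tail |>.trans
        (by simp)⟩ (fun v hv => hv.2.2.length_le)
    have hv : DEE.IsPalSub s v := ⟨hne, hpal, hpre.isInfix⟩
    refine ⟨v, hv, hS.mem hv (DEE.one_mem_occ_iff.mpr hpre) ?_ ?_⟩
    · intro u hu hl hi
      have hlt := DEE.length_link_lt hu.1
      have hle := hmax u ⟨hu.1, hu.2.1, DEE.one_mem_occ_iff.mp hi⟩
      rw [hl] at hlt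
      omega
    · rintro u hu hl ⟨i, ⟨hi, -, -⟩, h⟩
      have hlt := DEE.length_link_lt hu.1
      dsimp only at h
      omega
  · obtain ⟨v, ⟨hne, hpal, hsuf⟩, hmax⟩ := DEE.exists_maximal_length
      (P := fun v => v ≠ [] ∧ v.Palindrome ∧ v <:+ s) (n := s.length)
      ⟨[s.getLast hs], by simp, List.Palindrome.singleton _,
        ⟨s.dropLast, List.dropLast_append_getLast hs⟩⟩ (fun v hv => hv.2.2.length_le)
    have hv : DEE.IsPalSub s v := ⟨hne, hpal, hsuf.isInfix⟩
    have hvs := hsuf.length_le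
    refine ⟨v, hv, hS.mem hv (DEE.mem_occ_of_suffix hsuf) ?_ ?_⟩
    · rintro u hu hl ⟨-, h, -⟩
      have hlt := DEE.length_link_lt hu.1
      rw [hl] at hlt
      omega
    · rintro u hu hl ⟨i, hi, h⟩
      have hlt := DEE.length_link_lt hu.1
      dsimp only at h
      rw [hl] at hlt h
      have hle := hmax u ⟨hu.1, hu.2.1, DEE.suffix_of_mem_occ hi (by omega)⟩
      omega
end
end

section
/- Let s be a string, c a character, and v a non-empty palindrome. Then: (push_back) cnt(sc,v) = cnt(s,v) + 1 if v = sufpal(sc,|sc|), and cnt(sc,v) = cnt(s,v) otherwise; (push_front) cnt(cs,v) = cnt(s,v) + 1 if v = prepal(cs,1), and cnt(cs,v) = cnt(s,v) otherwise; moreover, if s is non-empty: (pop_back) cnt(s[1..|s|−1],v) = cnt(s,v) − 1 if v = sufpal(s,|s|), and cnt(s[1..|s|−1],v) = cnt(s,v) otherwise; (pop_front) cnt(s[2..|s|],v) = cnt(s,v) − 1 if v = prepal(s,1), and cnt(s[2..|s|],v) = cnt(s,v) otherwise. -/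
noncomputable section
open scoped Classical

namespace DEE

variable {α : Type*}

/-- Longest non-empty palindromic prefix of `t`. -/
def longestPalPrefix (t : List α) : List α :=
  t.take (sSup {l | 1 ≤ l ∧ l ≤ t.length ∧ (t.take l).Palindrome})

lemma palindrome_reverse_iff (t : List α) : t.reverse.Palindrome ↔ t.Palindrome := by
  simp only [List.Palindrome.iff_reverse_eq, List.reverse_reverse]
  exact eq_comm

lemma longestPalPrefix_palindrome (t : List α) : (longestPalPrefix t).Palindrome := by
  rcases t with _ | ⟨a, t⟩
  · simpa [longestPalPrefix] using List.Palindrome.nil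
  · have hmem : sSup {l | 1 ≤ l ∧ l ≤ (a :: t).length ∧ ((a :: t).take l).Palindrome} ∈
        {l | 1 ≤ l ∧ l ≤ (a :: t).length ∧ ((a :: t).take l).Palindrome} := by
      refine Nat.sSup_mem ⟨1, le_rfl, by simp, ?_⟩ ⟨(a :: t).length, fun l hl => hl.2.1⟩
      simpa using List.Palindrome.singleton a
    exact hmem.2.2

lemma longestPalPrefix_eq_self {t : List α} (ht : t.Palindrome) : longestPalPrefix t = t := by
  rcases eq_or_ne t [] with rfl | hne
  · simp [longestPalPrefix]
  · have hmax : IsGreatest {l | 1 ≤ l ∧ l ≤ t.length ∧ (t.take l).Palindrome} t.length :=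
      ⟨⟨List.length_pos_iff.2 hne, le_rfl, by simpa using ht⟩, fun l hl => hl.2.1⟩
    rw [longestPalPrefix, hmax.csSup_eq, List.take_length]

lemma longestPalPrefix_concat {t : List α} {c : α} (h : ¬ (t ++ [c]).Palindrome) :
    longestPalPrefix (t ++ [c]) = longestPalPrefix t := by
  have hset : {l | 1 ≤ l ∧ l ≤ (t ++ [c]).length ∧ ((t ++ [c]).take l).Palindrome} =
      {l | 1 ≤ l ∧ l ≤ t.length ∧ (t.take l).Palindrome} := by
    ext l
    simp only [Set.mem_ofPred_eq]
    refine and_congr_right fun _ => ⟨fun ⟨h2, h3⟩ => ?_, fun ⟨h2, h3⟩ => ?_⟩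
    · have hle : l ≤ t.length := by
        by_contra! hlt
        rw [List.take_of_length_le (by simpa using hlt)] at h3
        exact h h3
      exact ⟨hle, by rwa [List.take_append_of_le_length hle] at h3⟩
    · exact ⟨by simp; omega, by rwa [List.take_append_of_le_length h2]⟩
  have hle : sSup {l | 1 ≤ l ∧ l ≤ t.length ∧ (t.take l).Palindrome} ≤ t.length :=
    csSup_le' fun l hl => hl.2.1
  rw [longestPalPrefix, hset, List.take_append_of_le_length hle, longestPalPrefix]

lemma prepal_succ (s : List α) (i : ℕ) : prepal s (i + 1) = longestPalPrefix (s.drop i) := by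
  have hlen : prelen s (i + 1) =
      sSup {l | 1 ≤ l ∧ l ≤ (s.drop i).length ∧ ((s.drop i).take l).Palindrome} := by
    simp only [prelen, substr, List.length_drop, Nat.add_sub_cancel, Nat.add_sub_add_right]
    congr 1
    ext l
    simp only [Set.mem_ofPred_eq]
    refine and_congr_right fun h => ?_
    rw [show i + 1 + l - 1 - i = l by omega]
  rw [longestPalPrefix, ← hlen, prepal, substr]
  congr 1
  omega

lemma substr_suffix_eq (s : List α) {i l : ℕ} (hi : i ≤ s.length) (hl : l ≤ i) :
    substr s (i + 1 - l) i = ((s.take i).reverse.take l).reverse := by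
  rw [List.take_reverse, List.reverse_reverse, List.length_take_of_le hi, substr, List.drop_take]
  congr 1
  · omega
  · congr 1
    omega

lemma sufpal_eq (s : List α) {i : ℕ} (hi : i ≤ s.length) :
    sufpal s i = longestPalPrefix (s.take i).reverse := by
  have hlen : suflen s i = sSup {l | 1 ≤ l ∧ l ≤ (s.take i).reverse.length ∧
      ((s.take i).reverse.take l).Palindrome} := by
    rw [suflen]
    congr 1
    ext l
    simp only [Set.mem_ofPred_eq, List.length_reverse, List.length_take_of_le hi]
    refine and_congr_right fun _ => and_congr_right fun hl => ?_
    rw [substr_suffix_eq s hi hl, palindrome_reverse_iff]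
  have hle : suflen s i ≤ i := csSup_le' fun l hl => hl.2.1
  rw [sufpal, substr_suffix_eq s hi hle, hlen]
  exact (longestPalPrefix_palindrome _).reverse_eq

lemma ncard_one_le_le (n : ℕ) (p : ℕ → Prop) :
    {i | 1 ≤ i ∧ i ≤ n ∧ p i}.ncard = ∑ i ∈ Finset.range n, if p (i + 1) then 1 else 0 := by
  have hset : {i | 1 ≤ i ∧ i ≤ n ∧ p i} =
      (fun i => i + 1) '' ((Finset.range n).filter fun i => p (i + 1) : Set ℕ) := by
    ext i
    simp only [Set.mem_ofPred_eq, Set.mem_image, Finset.coe_filter, Finset.mem_range]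
    constructor
    · rintro ⟨h1, h2, h3⟩
      exact ⟨i - 1, ⟨by omega, by rwa [Nat.sub_add_cancel h1]⟩, by omega⟩
    · rintro ⟨j, ⟨h1, h2⟩, rfl⟩
      exact ⟨by omega, by omega, h2⟩
  rw [hset, Set.ncard_image_of_injective _ (add_left_injective 1), Set.ncard_coe_finset,
    Finset.card_filter]

lemma sufcnt_eq_sum (s v : List α) : sufcnt s v = ∑ i ∈ Finset.range s.length,
    if longestPalPrefix (s.take (i + 1)).reverse = v then 1 else 0 := by
  rw [sufcnt, ncard_one_le_le]
  refine Finset.sum_congr rfl fun i hi => ?_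
  simp only [sufpal_eq s (i := i + 1) (Finset.mem_range.1 hi)]

lemma precnt_eq_sum (s v : List α) : precnt s v = ∑ i ∈ Finset.range s.length,
    if longestPalPrefix (s.drop i) = v then 1 else 0 := by
  simp only [precnt, ncard_one_le_le, prepal_succ]

lemma sufcnt_concat (s : List α) (c : α) (v : List α) : sufcnt (s ++ [c]) v =
    sufcnt s v + if longestPalPrefix (s ++ [c]).reverse = v then 1 else 0 := by
  rw [sufcnt_eq_sum, sufcnt_eq_sum, List.length_append, List.length_singleton,
    Finset.sum_range_succ]
  congr 1
  · refine Finset.sum_congr rfl fun i hi => ?_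
    rw [List.take_append_of_le_length (Finset.mem_range.1 hi)]
  · rw [List.take_of_length_le (by simp)]

lemma precnt_cons (c : α) (s v : List α) : precnt (c :: s) v =
    precnt s v + if longestPalPrefix (c :: s) = v then 1 else 0 := by
  rw [precnt_eq_sum, precnt_eq_sum, List.length_cons, Finset.sum_range_succ']
  rfl

/-- Compares the longest palindromic prefixes and suffixes of a word with those of the word
without its last, respectively first, letter. -/
lemma longestPalPrefix_exchange (a : α) (s : List α) (c : α) (v : List α) :
    ((if longestPalPrefix (a :: (s ++ [c])) = v then 1 else 0) +
        if longestPalPrefix (s ++ [c]).reverse = v then 1 else 0) =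
      (if longestPalPrefix (a :: (s ++ [c])).reverse = v then 1 else 0) +
        if longestPalPrefix (a :: s) = v then 1 else 0 := by
  by_cases h : (a :: (s ++ [c])).Palindrome
  · have hrev := h.reverse_eq
    have hrest : (s ++ [c]).reverse = a :: s := by
      rw [List.reverse_cons, ← List.cons_append] at hrev
      exact (List.append_inj' hrev rfl).1
    rw [hrev, hrest]
  · rw [List.reverse_cons, longestPalPrefix_concat (c := a), ← List.cons_append,
      longestPalPrefix_concat (c := c) (by rwa [List.cons_append]), add_comm]
    rwa [← List.reverse_cons, palindrome_reverse_iff]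

lemma precnt_concat (s : List α) (c : α) (v : List α) : precnt (s ++ [c]) v =
    precnt s v + if longestPalPrefix (s ++ [c]).reverse = v then 1 else 0 := by
  induction s with
  | nil => exact precnt_cons c [] v
  | cons a s ih =>
    have h := longestPalPrefix_exchange a s c v
    rw [List.cons_append, precnt_cons, precnt_cons, ih]
    omega

lemma sufcnt_eq_precnt (s v : List α) : sufcnt s v = precnt s v := by
  induction s using List.reverseRecOn with
  | nil => rw [sufcnt_eq_sum, precnt_eq_sum]; rfl
  | append_singleton s c ih => rw [sufcnt_concat, precnt_concat, ih]

lemma cnt_concat (s : List α) (c : α) (v : List α) : cnt (s ++ [c]) v =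
    if v = sufpal (s ++ [c]) (s ++ [c]).length then cnt s v + 1 else cnt s v := by
  rw [sufpal_eq _ le_rfl, List.take_length, cnt, cnt, sufcnt_concat]
  simp only [eq_comm (a := v)]
  split_ifs <;> rfl

lemma cnt_cons (c : α) (s v : List α) : cnt (c :: s) v =
    if v = prepal (c :: s) 1 then cnt s v + 1 else cnt s v := by
  rw [← zero_add 1, prepal_succ, List.drop_zero, cnt, cnt, sufcnt_eq_precnt, sufcnt_eq_precnt,
    precnt_cons]
  simp only [eq_comm (a := v)]
  split_ifs <;> rfl

end DEE

/-- Update rule of `cnt` under the four deque operations. -/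
theorem cnt_update {α : Type*} (s : List α) (c : α) (v : List α)
    (hv : v ≠ []) (hvp : v.Palindrome) :
    (DEE.cnt (s ++ [c]) v =
        if v = DEE.sufpal (s ++ [c]) (s ++ [c]).length then DEE.cnt s v + 1
        else DEE.cnt s v) ∧
    (DEE.cnt (c :: s) v =
        if v = DEE.prepal (c :: s) 1 then DEE.cnt s v + 1 else DEE.cnt s v) ∧
    (s ≠ [] →
      DEE.cnt s.dropLast v =
        if v = DEE.sufpal s s.length then DEE.cnt s v - 1 else DEE.cnt s v) ∧
    (s ≠ [] →
      DEE.cnt s.tail v =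
        if v = DEE.prepal s 1 then DEE.cnt s v - 1 else DEE.cnt s v) := by
  refine ⟨DEE.cnt_concat s c v, DEE.cnt_cons c s v, fun hs => ?_, fun hs => ?_⟩
  · have h := DEE.cnt_concat s.dropLast (s.getLast hs) v
    rw [List.dropLast_append_getLast hs] at h
    split_ifs at h ⊢ <;> omega
  · have h := DEE.cnt_cons (s.head hs) s.tail v
    rw [List.cons_head_tail hs] at h
    split_ifs at h ⊢ <;> omega
end
end
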